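/- arXiv:2001.05368 — 2 statements merged into one kernel-verified Lean document; each statement's English description precedes it below -/
import Mathlib

section
/- Uniqueness for homothetic initial data: assume U ∈ C²(S¹) positive with global minimum at θ*, α ∈ (0,2), h < 0, and 0 < r* ≤ (−U(θ*)/h)^{1/α}. Then the Maupertuis functional M_h has a unique minimizer in H_coll^{q*} with q* = r* e^{iθ*}, namely the monotone homothetic arc u(s) = r(s) e^{iθ*} with r monotone decreasing from r* to 0. -/
open Set MeasureTheory intervalIntegral

noncomputable def Vpot (α : ℝ) (U : EuclideanSpace ℝ (Fin 2) → ℝ)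
    (x : EuclideanSpace ℝ (Fin 2)) : ℝ :=
  ‖x‖ ^ (-α) * U (‖x‖⁻¹ • x)

/-- The Maupertuis functional `M_h(u) = (1/2)∫₀¹|u̇|² · ∫₀¹(h+V(u))`. -/
noncomputable def Maupertuis (α h : ℝ) (U : EuclideanSpace ℝ (Fin 2) → ℝ)
    (u : ℝ → EuclideanSpace ℝ (Fin 2)) : ℝ :=
  ((1/2) * ∫ s in (0:ℝ)..1, ‖deriv u s‖ ^ 2) *
    (∫ s in (0:ℝ)..1, (h + Vpot α U (u s)))

/-- The class `H_coll^q`. -/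
def HcollQ (α h : ℝ) (U : EuclideanSpace ℝ (Fin 2) → ℝ)
    (q : EuclideanSpace ℝ (Fin 2)) (u : ℝ → EuclideanSpace ℝ (Fin 2)) : Prop :=
  ContinuousOn u (Icc 0 1) ∧ (∀ s ∈ Ioo (0:ℝ) 1, DifferentiableAt ℝ u s) ∧
    u 0 = q ∧ u 1 = 0 ∧ (∀ s ∈ Icc (0:ℝ) 1, ‖u s‖ ≤ ‖q‖) ∧
    (∀ᵐ s, s ∈ Icc (0:ℝ) 1 → u s ≠ 0) ∧
    IntervalIntegrable (fun s => ‖deriv u s‖ ^ 2) volume 0 1 ∧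
    IntervalIntegrable (fun s => h + Vpot α U (u s)) volume 0 1

/-- The unit vector `e^{iθ}` of the plane. -/
noncomputable def unitPt (θ : ℝ) : EuclideanSpace ℝ (Fin 2) :=
  (EuclideanSpace.equiv (Fin 2) ℝ).symm ![Real.cos θ, Real.sin θ]

/-- `u` is a monotone homothetic collision arc in the direction `θ*`, from radius
`r*` down to `0`. -/
def IsMonotoneHomothetic (θstar rstar : ℝ)
    (u : ℝ → EuclideanSpace ℝ (Fin 2)) : Prop :=
  ∃ ρ : ℝ → ℝ, (∀ s ∈ Icc (0:ℝ) 1, u s = ρ s • unitPt θstar) ∧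
    ρ 0 = rstar ∧ ρ 1 = 0 ∧ (∀ s ∈ Icc (0:ℝ) 1, 0 ≤ ρ s) ∧
    AntitoneOn ρ (Icc 0 1)

/-- The radial Jacobi density. -/
noncomputable def gJ (α h m x : ℝ) : ℝ := √(h + m * x ^ (-α))

/-- Its primitive. -/
noncomputable def GJ (α h m x : ℝ) : ℝ := ∫ t in (0:ℝ)..x, gJ α h m t

lemma gJ_nonneg (α h m x : ℝ) : 0 ≤ gJ α h m x := Real.sqrt_nonneg _

lemma gJ_cont {α h m x : ℝ} (hx : 0 < x) : ContinuousAt (gJ α h m) x := by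
  unfold gJ
  have : ContinuousAt (fun x : ℝ => x ^ (-α)) x := Real.continuousAt_rpow_const _ _ (Or.inl hx.ne')
  fun_prop

lemma gJ_meas (α h m : ℝ) : Measurable (gJ α h m) := by
  unfold gJ; fun_prop

lemma gJ_int {α h m : ℝ} (hα0 : 0 < α) (hα : α < 2) (hh : h < 0) (hm : 0 < m) (b : ℝ) (hb : 0 ≤ b) :
    IntervalIntegrable (gJ α h m) volume 0 b := by
  have h1 : IntervalIntegrable (fun x : ℝ => √m * x ^ (-(α/2))) volume 0 b :=
    (intervalIntegrable_rpow' (by linarith)).const_mul _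
  refine h1.mono_fun' (gJ_meas α h m).aestronglyMeasurable ?_
  filter_upwards [ae_restrict_mem measurableSet_uIoc] with x hx
  rw [uIoc_of_le hb] at hx
  rw [Real.norm_of_nonneg (gJ_nonneg _ _ _ _)]
  unfold gJ
  have h2 : x ^ (-(α/2)) = √(x ^ (-α)) := by
    rw [Real.sqrt_eq_rpow, ← Real.rpow_mul hx.1.le]; congr 1; ring
  rw [h2, ← Real.sqrt_mul hm.le]
  exact Real.sqrt_le_sqrt (by linarith)

lemma GJ_cont {α h m : ℝ} (hα0 : 0 < α) (hα : α < 2) (hh : h < 0) (hm : 0 < m) (b : ℝ) (hb : 0 ≤ b) :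
    ContinuousOn (GJ α h m) (Icc 0 b) := by
  have := continuousOn_primitive_interval (μ := volume) (a := 0) (b := b) (f := gJ α h m) (by
    rw [uIcc_of_le hb, integrableOn_Icc_iff_integrableOn_Ioc]
    exact (intervalIntegrable_iff_integrableOn_Ioc_of_le hb).1 (gJ_int hα0 hα hh hm b hb))
  rwa [uIcc_of_le hb] at this

lemma GJ_deriv {α h m : ℝ} (hα0 : 0 < α) (hα : α < 2) (hh : h < 0) (hm : 0 < m) {x : ℝ} (hx : 0 < x) :
    HasDerivAt (GJ α h m) (gJ α h m x) x :=
  integral_hasDerivAt_right (gJ_int hα0 hα hh hm x hx.le)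
    (gJ_meas α h m).stronglyMeasurable.stronglyMeasurableAtFilter (gJ_cont hx)

lemma gpos_aux {α h m R : ℝ} (hα0 : 0 < α) (hh : h < 0) (hm : 0 < m) (hR : 0 < R)
    (hRle : R ≤ (-m / h) ^ (1/α)) {x : ℝ} (hx : 0 < x) (hxR : x ≤ R) : 0 ≤ h + m * x ^ (-α) := by
  have hq : 0 < -m / h := div_pos_of_neg_of_neg (by linarith) hh
  have h1 : x ^ α ≤ -m / h := by
    calc x ^ α ≤ ((-m / h) ^ (1/α)) ^ α := Real.rpow_le_rpow hx.le (hxR.trans hRle) hα0.le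
      _ = -m / h := by
        rw [← Real.rpow_mul hq.le, one_div, inv_mul_cancel₀ hα0.ne', Real.rpow_one]
  rw [le_div_iff_of_neg hh] at h1
  have hp : 0 < x ^ α := Real.rpow_pos_of_pos hx _
  rw [Real.rpow_neg hx.le]
  have : h + m * (x^α)⁻¹ = (x^α * h + m) / x^α := by field_simp
  rw [this]
  exact div_nonneg (by linarith) hp.le

lemma gpos_aux' {α h m R : ℝ} (hα0 : 0 < α) (hh : h < 0) (hm : 0 < m) (hR : 0 < R)
    (hRle : R ≤ (-m / h) ^ (1/α)) {x : ℝ} (hx : 0 < x) (hxR : x < R) : 0 < h + m * x ^ (-α) := by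
  have h1 := gpos_aux hα0 hh hm hR hRle hR le_rfl
  have h2 : R ^ (-α) < x ^ (-α) := Real.rpow_lt_rpow_of_neg hx hxR (by linarith)
  nlinarith

lemma ginv_int {α h m R : ℝ} (hα0 : 0 < α) (hα : α < 2) (hh : h < 0) (hm : 0 < m) (hR : 0 < R)
    (hRle : R ≤ (-m / h) ^ (1/α)) : IntervalIntegrable (fun x => (gJ α h m x)⁻¹) volume 0 R := by
  have hk : ∀ x ∈ Ioo 0 R, 0 < h * x ^ α + m := by
    intro x hx
    have h1 := gpos_aux' hα0 hh hm hR hRle hx.1 hx.2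
    have hp : 0 < x ^ α := Real.rpow_pos_of_pos hx.1 _
    rw [Real.rpow_neg hx.1.le] at h1
    have : h * x ^ α + m = (h + m * (x^α)⁻¹) * x^α := by field_simp
    rw [this]; positivity
  have hd : IntervalIntegrable (fun x => -(h * (α * x ^ (α - 1)) / (2 * √(h * x ^ α + m)))) volume 0 R := by
    apply intervalIntegrable_deriv_of_nonneg (g := fun x => -√(h * x ^ α + m))
    · have : Continuous (fun x : ℝ => x ^ α) := Real.continuous_rpow_const hα0.le
      fun_prop
    · intro x hx
      rw [min_eq_left hR.le, max_eq_right hR.le] at hx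
      have h1 := ((((Real.hasDerivAt_rpow_const (p := α) (Or.inl hx.1.ne')).const_mul h).add_const m).sqrt (hk x hx).ne').neg
      exact h1
    · intro x hx
      rw [min_eq_left hR.le, max_eq_right hR.le] at hx
      have : 0 < x ^ (α-1) := Real.rpow_pos_of_pos hx.1 _
      rw [← neg_div]
      apply div_nonneg _ (by positivity)
      nlinarith [mul_pos hα0 this]
  have hc : ContinuousOn (fun x : ℝ => 2 / (-h * α) * x ^ (1 - α/2)) (uIcc 0 R) := by
    have : Continuous (fun x : ℝ => x ^ (1 - α/2)) := Real.continuous_rpow_const (by linarith)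
    fun_prop
  have := hd.continuousOn_mul hc
  refine this.congr_ae ?_
  have hne : ∀ᵐ x ∂(volume : Measure ℝ), x ≠ R := by simp [ae_iff]
  filter_upwards [ae_restrict_mem measurableSet_uIoc, ae_restrict_of_ae hne] with x hx hxR
  rw [uIoc_of_le hR.le] at hx
  have hx' : x ∈ Ioo 0 R := ⟨hx.1, lt_of_le_of_ne hx.2 hxR⟩
  have h1 := hk x hx'
  have h0 := hx.1
  have hg : gJ α h m x = √(h * x ^ α + m) * x ^ (-(α/2)) := by
    have h2 : x ^ (-(α/2)) = √(x ^ (-α)) := by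
      rw [Real.sqrt_eq_rpow, ← Real.rpow_mul hx.1.le]; congr 1; ring
    rw [h2, ← Real.sqrt_mul h1.le, gJ, add_mul, mul_assoc, ← Real.rpow_add h0]
    simp
  have e1 : x ^ (1 - α/2) * x ^ (α - 1) * x ^ (-(α/2)) = 1 := by
    rw [← Real.rpow_add h0, ← Real.rpow_add h0]; ring_nf; simp
  have h3 : √(h * x ^ α + m) ≠ 0 := (Real.sqrt_pos.2 h1).ne'
  have h4 : x ^ (-(α/2)) ≠ 0 := (Real.rpow_pos_of_pos h0 _).ne'
  rw [hg]
  symm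
  apply inv_eq_of_mul_eq_one_right
  have hh' := hh.ne
  have hα' := hα0.ne'
  generalize x ^ (1 - α/2) = X at *
  generalize x ^ (α - 1) = Y at *
  generalize x ^ (-(α/2)) = Z at *
  generalize √(h * x ^ α + m) = W at *
  field_simp
  linear_combination e1


lemma exists_rho {α h m R : ℝ} (hα0 : 0 < α) (hα : α < 2) (hh : h < 0) (hm : 0 < m) (hR : 0 < R)
    (hRle : R ≤ (-m / h) ^ (1/α)) : ∃ (ρ : ℝ → ℝ) (c : ℝ), 0 < c ∧ Continuous ρ ∧ ρ 0 = R ∧ ρ 1 = 0 ∧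
      (∀ s ∈ Ioo (0:ℝ) 1, ρ s ∈ Ioo 0 R) ∧ (∀ s, ρ s ∈ Icc 0 R) ∧ Antitone ρ ∧
      ∀ s ∈ Ioo (0:ℝ) 1, HasDerivAt ρ (-c * gJ α h m (ρ s)) s := by
  set F : ℝ → ℝ := fun x => ∫ t in (0:ℝ)..x, (gJ α h m t)⁻¹ with hF
  have hint := ginv_int hα0 hα hh hm hR hRle
  have hgp : ∀ x ∈ Ioo 0 R, 0 < gJ α h m x := fun x hx =>
    Real.sqrt_pos.2 (gpos_aux' hα0 hh hm hR hRle hx.1 hx.2)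
  have hFc : ContinuousOn F (Icc 0 R) := by
    have := continuousOn_primitive_interval (μ := volume) (a := 0) (b := R)
      (f := fun x => (gJ α h m x)⁻¹) (by
      rw [uIcc_of_le hR.le, integrableOn_Icc_iff_integrableOn_Ioc]
      exact (intervalIntegrable_iff_integrableOn_Ioc_of_le hR.le).1 hint)
    rwa [uIcc_of_le hR.le] at this
  have hFd : ∀ x ∈ Ioo 0 R, HasDerivAt F (gJ α h m x)⁻¹ x := by
    intro x hx
    refine integral_hasDerivAt_right (hint.mono_set ?_)
      (gJ_meas α h m).inv.stronglyMeasurable.stronglyMeasurableAtFilter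
      ((gJ_cont hx.1).inv₀ (hgp x hx).ne')
    rw [uIcc_of_le hR.le, uIcc_of_le hx.1.le]
    exact Icc_subset_Icc le_rfl hx.2.le
  have hmono : StrictMonoOn F (Icc 0 R) := by
    apply strictMonoOn_of_deriv_pos (convex_Icc 0 R) hFc
    intro x hx
    rw [interior_Icc] at hx
    rw [(hFd x hx).deriv]
    exact inv_pos.2 (hgp x hx)
  have hF0 : F 0 = 0 := by simp [hF]
  obtain ⟨c, hcdef⟩ : ∃ c, c = F R := ⟨_, rfl⟩
  have hc : 0 < c := by
    rw [← hF0, hcdef]; exact hmono (left_mem_Icc.2 hR.le) (right_mem_Icc.2 hR.le) hR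
  have himg : F '' Icc 0 R = Icc 0 c := by
    rw [hcdef]
    apply Subset.antisymm
    · rintro _ ⟨x, hx, rfl⟩
      refine ⟨?_, hmono.monotoneOn hx (right_mem_Icc.2 hR.le) hx.2⟩
      rw [← hF0]; exact hmono.monotoneOn (left_mem_Icc.2 hR.le) hx hx.1
    · have := intermediate_value_Icc hR.le hFc
      rwa [hF0] at this
  let e : Icc 0 R ≃o Icc 0 c := (hmono.orderIso F _).trans (OrderIso.setCongr _ _ himg)
  have he : ∀ x : Icc 0 R, ((e x : Icc 0 c) : ℝ) = F x := fun x => rfl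
  let ρ : ℝ → ℝ := fun s => (e.symm (projIcc 0 c hc.le (c * (1 - s))) : ℝ)
  have hFρ : ∀ s ∈ Icc (0:ℝ) 1, F (ρ s) = c * (1 - s) := by
    intro s hs
    have : F (ρ s) = ((e (e.symm (projIcc 0 c hc.le (c * (1 - s)))) : Icc 0 c) : ℝ) := (he _).symm
    rw [this, e.apply_symm_apply, projIcc_of_mem]
    exact ⟨mul_nonneg hc.le (by linarith [hs.2]), by nlinarith [hs.1]⟩
  have hρm : ∀ s, ρ s ∈ Icc 0 R := fun s => (e.symm _).2
  have hinj := hmono.injOn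
  have hρ0 : ρ 0 = R := hinj (hρm 0) (right_mem_Icc.2 hR.le) (by rw [hFρ 0 (by simp)]; simp [hcdef])
  have hρ1 : ρ 1 = 0 := hinj (hρm 1) (left_mem_Icc.2 hR.le) (by rw [hFρ 1 (by simp), hF0]; simp)
  have hcont : Continuous ρ := by
    have := e.symm.continuous
    have h2 : Continuous (projIcc 0 c hc.le) := continuous_projIcc
    exact continuous_subtype_val.comp (this.comp (h2.comp (by fun_prop)))
  have hioo : ∀ s ∈ Ioo (0:ℝ) 1, ρ s ∈ Ioo 0 R := by
    intro s hs
    have h1 := hFρ s ⟨hs.1.le, hs.2.le⟩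
    refine ⟨lt_of_le_of_ne (hρm s).1 ?_, lt_of_le_of_ne (hρm s).2 ?_⟩
    · intro h0
      rw [← h0, hF0] at h1
      have : 0 < c * (1 - s) := mul_pos hc (by linarith [hs.2])
      linarith
    · intro h0
      rw [h0] at h1
      nlinarith [mul_pos hc hs.1]
  refine ⟨ρ, c, hc, hcont, hρ0, hρ1, hioo, hρm, ?_, ?_⟩
  · intro s t hst
    have : projIcc 0 c hc.le (c * (1 - t)) ≤ projIcc 0 c hc.le (c * (1 - s)) :=
      monotone_projIcc _ (by nlinarith)
    exact e.symm.monotone this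
  · intro s hs
    have hd : HasDerivAt (fun s : ℝ => c * (1 - s)) (-c) s := by
      have := ((hasDerivAt_id s).const_sub 1).const_mul c
      simpa using this
    have := HasDerivAt.of_comp_left hcont.continuousAt (hFd _ (hioo s hs)) hd
      (inv_ne_zero (hgp _ (hioo s hs)).ne') (by
        filter_upwards [Ioo_mem_nhds hs.1 hs.2] with t ht
        exact hFρ t ⟨ht.1.le, ht.2.le⟩)
    simpa using this

lemma candidate {α h R : ℝ} (hα0 : 0 < α) (hα : α < 2) (hh : h < 0)
    (U : EuclideanSpace ℝ (Fin 2) → ℝ) (θ : ℝ) (hp : ‖unitPt θ‖ = 1)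
    (hm : 0 < U (unitPt θ)) (hR : 0 < R)
    (hRle : R ≤ (-(U (unitPt θ)) / h) ^ (1/α)) :
    ∃ u, HcollQ α h U (R • unitPt θ) u ∧ IsMonotoneHomothetic θ R u ∧
      Maupertuis α h U u = (1/2) * (GJ α h (U (unitPt θ)) R) ^ 2 := by
  obtain ⟨ρ, c, hc, hcont, h0, h1, hioo, hicc, hanti, hder⟩ := exists_rho hα0 hα hh hm hR hRle
  set p := unitPt θ with hpdef
  set m := U p with hmdef
  set u : ℝ → EuclideanSpace ℝ (Fin 2) := fun s => ρ s • p with hu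
  have hud : ∀ s ∈ Ioo (0:ℝ) 1, HasDerivAt u ((-c * gJ α h m (ρ s)) • p) s := fun s hs =>
    (hder s hs).smul_const p
  have hsq : ∀ s ∈ Ioo (0:ℝ) 1, gJ α h m (ρ s) ^ 2 = h + m * ρ s ^ (-α) := fun s hs =>
    Real.sq_sqrt (gpos_aux' hα0 hh hm hR hRle (hioo s hs).1 (hioo s hs).2).le
  have hn : ∀ s ∈ Ioo (0:ℝ) 1, ‖deriv u s‖ ^ 2 = c ^ 2 * gJ α h m (ρ s) ^ 2 := by
    intro s hs
    rw [(hud s hs).deriv, norm_smul, hp, mul_one, Real.norm_eq_abs, sq_abs]; ring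
  have hV : ∀ s ∈ Ioo (0:ℝ) 1, h + Vpot α U (u s) = gJ α h m (ρ s) ^ 2 := by
    intro s hs
    have hs0 := (hioo s hs).1
    have hnu : ‖u s‖ = ρ s := by rw [hu]; simp [norm_smul, hp, abs_of_pos hs0]
    rw [hsq s hs, Vpot, hnu, hu]
    simp only [smul_smul]
    rw [inv_mul_cancel₀ hs0.ne', one_smul]; ring
  have hmaps : MapsTo ρ (Icc 0 1) (Icc 0 R) := fun s _ => hicc s
  have hGc : ContinuousOn (fun s => -GJ α h m (ρ s)) (Icc 0 1) :=
    ((GJ_cont hα0 hα hh hm R hR.le).comp hcont.continuousOn hmaps).neg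
  have hGd : ∀ s ∈ Ioo (0:ℝ) 1, HasDerivAt (fun s => -GJ α h m (ρ s)) (c * gJ α h m (ρ s) ^ 2) s := by
    intro s hs
    have := ((GJ_deriv hα0 hα hh hm (hioo s hs).1).comp s (hder s hs)).neg
    exact this.congr_deriv (by ring)
  have hI : IntervalIntegrable (fun s => c * gJ α h m (ρ s) ^ 2) volume 0 1 := by
    rw [intervalIntegrable_iff_integrableOn_Ioc_of_le zero_le_one]
    exact integrableOn_deriv_of_nonneg hGc hGd (fun s _ => by positivity)
  have hval : ∫ s in (0:ℝ)..1, c * gJ α h m (ρ s) ^ 2 = GJ α h m R := by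
    rw [integral_eq_sub_of_hasDerivAt_of_le zero_le_one hGc hGd hI, h0, h1]
    simp [GJ]
  have hI' : IntervalIntegrable (fun s => gJ α h m (ρ s) ^ 2) volume 0 1 := by
    have := hI.const_mul c⁻¹
    refine this.congr_ae (Filter.Eventually.of_forall fun s => ?_)
    simp [hc.ne']
  have hne : ∀ᵐ x ∂(volume : Measure ℝ), x ≠ 1 := by simp [ae_iff]
  have hne0 : ∀ᵐ x ∂(volume : Measure ℝ), x ≠ 0 := by simp [ae_iff]
  have hae1 : (fun s => c ^ 2 * gJ α h m (ρ s) ^ 2) =ᵐ[volume.restrict (uIoc 0 1)]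
      fun s => ‖deriv u s‖ ^ 2 := by
    filter_upwards [ae_restrict_mem measurableSet_uIoc, ae_restrict_of_ae hne] with s hs hs1
    rw [uIoc_of_le zero_le_one] at hs
    exact (hn s ⟨hs.1, lt_of_le_of_ne hs.2 hs1⟩).symm
  have hae2 : (fun s => gJ α h m (ρ s) ^ 2) =ᵐ[volume.restrict (uIoc 0 1)]
      fun s => h + Vpot α U (u s) := by
    filter_upwards [ae_restrict_mem measurableSet_uIoc, ae_restrict_of_ae hne] with s hs hs1
    rw [uIoc_of_le zero_le_one] at hs
    exact (hV s ⟨hs.1, lt_of_le_of_ne hs.2 hs1⟩).symm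
  refine ⟨u, ⟨?_, ?_, ?_, ?_, ?_, ?_, ?_, ?_⟩, ⟨ρ, fun s _ => rfl, h0, h1, fun s _ => (hicc s).1, hanti.antitoneOn _⟩, ?_⟩
  · exact (hcont.smul continuous_const).continuousOn
  · exact fun s hs => (hud s hs).differentiableAt
  · simp [hu, h0]
  · simp [hu, h1]
  · intro s _
    simp only [hu, norm_smul, hp, mul_one, Real.norm_eq_abs, abs_of_pos hR, abs_of_nonneg (hicc s).1]
    exact (hicc s).2
  · filter_upwards [hne, hne0] with s hs1 hs0 hs
    have hs' : s ∈ Ioo (0:ℝ) 1 := ⟨lt_of_le_of_ne hs.1 (Ne.symm hs0), lt_of_le_of_ne hs.2 hs1⟩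
    refine smul_ne_zero (hioo s hs').1.ne' ?_
    intro hz; rw [hz] at hp; simp at hp
  · exact (hI'.const_mul (c^2)).congr_ae hae1
  · exact hI'.congr_ae hae2
  · rw [Maupertuis, ← integral_congr_ae_restrict hae1, ← integral_congr_ae_restrict hae2, ← hval,
      intervalIntegral.integral_const_mul, intervalIntegral.integral_const_mul]
    ring

lemma norm_deriv_aux {u : ℝ → EuclideanSpace ℝ (Fin 2)} {s : ℝ} (hd : DifferentiableAt ℝ u s)
    (hne : u s ≠ 0) : ∃ r', HasDerivAt (fun s => ‖u s‖) r' s ∧ |r'| ≤ ‖deriv u s‖ := by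
  have h1 : DifferentiableAt ℝ (fun s => ‖u s‖) s := hd.norm ℝ hne
  refine ⟨_, h1.hasDerivAt, ?_⟩
  have h2 := h1.hasDerivAt.pow 2
  have h3 := hd.hasDerivAt.norm_sq
  have h4 := h2.unique h3
  have h5 := abs_real_inner_le_norm (u s) (deriv u s)
  have h6 : 0 < ‖u s‖ := norm_pos_iff.2 hne
  have h7 : inner ℝ (u s) (deriv u s) = ‖u s‖ * deriv (fun s => ‖u s‖) s := by
    simp at h4; linarith
  rw [h7, abs_mul, abs_of_pos h6] at h5
  exact le_of_mul_le_mul_left h5 h6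

/-- If `D = 0` then the radial derivative is minus the speed. -/
lemma rigid_aux {μ n f g r : ℝ} (hμ : 0 < μ) (hn : 0 ≤ n) (hg : 0 ≤ g) (hgf : g ^ 2 ≤ f)
    (hr : |r| ≤ n) (hD : μ ^ 2 * n ^ 2 + f + 2 * μ * (g * r) = 0) : r = -n := by
  have h1 := abs_le.1 hr
  have hf : 0 ≤ f := (sq_nonneg g).trans hgf
  set q := √f with hq
  have hq2 : q ^ 2 = f := Real.sq_sqrt hf
  have hq0 : 0 ≤ q := Real.sqrt_nonneg _
  have hgq : g ≤ q := Real.le_sqrt_of_sq_le hgf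
  have h2 : 0 ≤ n * q + g * r := by nlinarith [mul_nonneg hg (by linarith : 0 ≤ r + n), mul_nonneg hn (sub_nonneg.2 hgq)]
  have h3 : (μ * n - q) ^ 2 + 2 * μ * (n * q + g * r) = 0 := by rw [← hD, ← hq2]; ring
  have h4 : 0 ≤ 2 * μ * (n * q + g * r) := by positivity
  have h5 : μ * n - q = 0 := by
    have : (μ * n - q) ^ 2 = 0 := le_antisymm (by linarith) (sq_nonneg _)
    exact pow_eq_zero_iff (by norm_num) |>.1 this
  have h6 : n * q + g * r = 0 := by
    have : 2 * μ * (n * q + g * r) = 0 := le_antisymm (by nlinarith [sq_nonneg (μ * n - q)]) h4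
    rcases mul_eq_zero.1 this with h | h
    · linarith
    · exact h
  rcases hn.eq_or_lt with h7 | h7
  · rw [← h7] at h1 ⊢; linarith [h1.1, h1.2]
  · have hqp : 0 < q := by nlinarith [mul_pos hμ h7]
    by_contra hne
    have h8 : 0 < r + n := lt_of_le_of_ne (by linarith) (fun h => hne (by linarith))
    -- `n * q + g * r = g * (r + n) + n * (q - g)`
    have h9 : g * (r + n) + n * (q - g) = 0 := by linarith
    have h10 : n * (q - g) = 0 := le_antisymm (by nlinarith [mul_nonneg hg h8.le]) (mul_nonneg hn (sub_nonneg.2 hgq))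
    have h11 : q = g := by
      rcases mul_eq_zero.1 h10 with h | h <;> linarith
    rw [← h11] at h9
    nlinarith [mul_pos hqp h8]

lemma D_nonneg {μ n f g r : ℝ} (hμ : 0 ≤ μ) (hn : 0 ≤ n) (hg : 0 ≤ g) (hgf : g ^ 2 ≤ f)
    (hr : |r| ≤ n) : 0 ≤ μ ^ 2 * n ^ 2 + f + 2 * μ * (g * r) := by
  have h1 := abs_le.1 hr
  have : 0 ≤ 2 * μ * (g * (r + n)) := by
    have : 0 ≤ r + n := by linarith
    positivity
  nlinarith [sq_nonneg (μ * n - g)]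

lemma first_zero {u : ℝ → EuclideanSpace ℝ (Fin 2)} (hc : ContinuousOn u (Icc 0 1))
    (h0 : u 0 ≠ 0) (h1 : u 1 = 0) : ∃ τ, 0 < τ ∧ τ ≤ 1 ∧ u τ = 0 ∧ ∀ s, 0 ≤ s → s < τ → u s ≠ 0 := by
  have hcl : IsCompact (Icc (0:ℝ) 1 ∩ u ⁻¹' {0}) :=
    isCompact_Icc.of_isClosed_subset (hc.preimage_isClosed_of_isClosed isClosed_Icc isClosed_singleton)
      inter_subset_left
  obtain ⟨τ, hτ, hmin⟩ := hcl.exists_isLeast ⟨1, by simp, h1⟩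
  refine ⟨τ, lt_of_le_of_ne hτ.1.1 ?_, hτ.1.2, hτ.2, ?_⟩
  · rintro rfl; exact h0 hτ.2
  · intro s hs hsτ hz
    exact absurd (hmin ⟨⟨hs, hsτ.le.trans hτ.1.2⟩, hz⟩) (not_le.2 hsτ)

set_option maxHeartbeats 2000000 in
lemma lower {α h R : ℝ} (hα0 : 0 < α) (hα : α < 2) (hh : h < 0)
    (U : EuclideanSpace ℝ (Fin 2) → ℝ) (p : EuclideanSpace ℝ (Fin 2)) (hp : ‖p‖ = 1)
    (hm : 0 < U p) (hmin : ∀ s : EuclideanSpace ℝ (Fin 2), ‖s‖ = 1 → U p ≤ U s) (hR : 0 < R)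
    (hRle : R ≤ (-(U p) / h) ^ (1/α)) (u : ℝ → EuclideanSpace ℝ (Fin 2))
    (hu : HcollQ α h U (R • p) u) :
    (1/2) * (GJ α h (U p) R) ^ 2 ≤ Maupertuis α h U u ∧
    (Maupertuis α h U u ≤ (1/2) * (GJ α h (U p) R) ^ 2 →
      ∀ s ∈ Icc (0:ℝ) 1, ∀ t ∈ Icc (0:ℝ) 1, s ≤ t → ‖u s - u t‖ ≤ ‖u s‖ - ‖u t‖) := by
  obtain ⟨hc, hd, hu0, hu1, hb, hae, hI1, hI2⟩ := hu
  have hnq : ‖R • p‖ = R := by rw [norm_smul, hp, mul_one, Real.norm_of_nonneg hR.le]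
  rw [hnq] at hb
  have hu00 : u 0 ≠ 0 := by rw [hu0, ← norm_pos_iff, hnq]; exact hR
  obtain ⟨τ, hτ0, hτ1, hτz, hτne⟩ := first_zero hc hu00 hu1
  set m := U p with hmdef
  set f : ℝ → ℝ := fun s => h + Vpot α U (u s) with hf
  have hfg : ∀ s ∈ Icc (0:ℝ) 1, u s ≠ 0 → gJ α h m ‖u s‖ ^ 2 ≤ f s := by
    intro s hs hne
    have h6 : 0 < ‖u s‖ := norm_pos_iff.2 hne
    have h7 : 0 < ‖u s‖ ^ (-α) := Real.rpow_pos_of_pos h6 _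
    rw [gJ, Real.sq_sqrt (gpos_aux hα0 hh hm hR hRle h6 (hb s hs))]
    have : m ≤ U (‖u s‖⁻¹ • u s) := hmin _ (by
      rw [norm_smul, norm_inv, norm_norm, inv_mul_cancel₀ h6.ne'])
    simp only [hf, Vpot]
    nlinarith
  -- nonnegativity of f a.e. on [0,1]
  have hf0 : ∀ᵐ s ∂(volume : Measure ℝ), s ∈ Icc (0:ℝ) 1 → 0 ≤ f s := by
    filter_upwards [hae] with s hs hs1
    exact (sq_nonneg _).trans (hfg s hs1 (hs hs1))
  set N : ℝ → ℝ := fun s => ‖deriv u s‖ ^ 2 with hN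
  have hsub1 : Icc 0 τ ⊆ Icc (0:ℝ) 1 := Icc_subset_Icc le_rfl hτ1
  have hin : ∀ s ∈ Ioo 0 τ, s ∈ Ioo (0:ℝ) 1 ∧ u s ≠ 0 := fun s hs =>
    ⟨⟨hs.1, hs.2.trans_le hτ1⟩, hτne s hs.1.le hs.2⟩
  have hrad : ∀ s ∈ Ioo 0 τ, HasDerivAt (fun s => ‖u s‖) (deriv (fun s => ‖u s‖) s) s ∧
      |deriv (fun s => ‖u s‖) s| ≤ ‖deriv u s‖ := by
    intro s hs
    obtain ⟨r', h1, h2⟩ := norm_deriv_aux (hd s (hin s hs).1) (hin s hs).2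
    rw [h1.deriv]; exact ⟨h1, h2⟩
  set r : ℝ → ℝ := deriv (fun s => ‖u s‖) with hr
  have hnc : ContinuousOn (fun s => ‖u s‖) (Icc 0 τ) := (hc.mono hsub1).norm
  have hGc : ContinuousOn (fun s => GJ α h m ‖u s‖) (Icc 0 τ) :=
    (GJ_cont hα0 hα hh hm R hR.le).comp hnc (fun s hs => ⟨norm_nonneg _, hb s (hsub1 hs)⟩)
  have hGd : ∀ s ∈ Ioo 0 τ, HasDerivAt (fun s => GJ α h m ‖u s‖) (gJ α h m ‖u s‖ * r s) s :=
    fun s hs => HasDerivAt.comp (h₂ := GJ α h m) (h := fun s => ‖u s‖) s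
      (GJ_deriv hα0 hα hh hm (norm_pos_iff.2 (hin s hs).2)) (hrad s hs).1
  have hmem : ∀ᵐ s ∂(volume.restrict (uIoc 0 τ)), s ∈ Ioo 0 τ := by
    have hne : ∀ᵐ x ∂(volume : Measure ℝ), x ≠ τ := by simp [ae_iff]
    filter_upwards [ae_restrict_mem measurableSet_uIoc, ae_restrict_of_ae hne] with s hs hs1
    rw [uIoc_of_le hτ0.le] at hs
    exact ⟨hs.1, lt_of_le_of_ne hs.2 hs1⟩
  have hss : uIcc 0 τ ⊆ uIcc (0:ℝ) 1 := by rw [uIcc_of_le hτ0.le, uIcc_of_le zero_le_one]; exact hsub1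
  have hss' : uIcc τ 1 ⊆ uIcc (0:ℝ) 1 := by
    rw [uIcc_of_le hτ1, uIcc_of_le zero_le_one]; exact Icc_subset_Icc hτ0.le le_rfl
  have hN0 := hI1.mono_set hss
  have hN1 := hI1.mono_set hss'
  have hf00 := hI2.mono_set hss
  have hf01 := hI2.mono_set hss'
  have hPint : IntervalIntegrable (fun s => gJ α h m ‖u s‖ * r s) volume 0 τ := by
    refine (hN0.add hf00).mono_fun' ?_ ?_
    · refine (measurable_deriv (fun s => GJ α h m ‖u s‖)).aestronglyMeasurable.congr ?_
      filter_upwards [hmem] with s hs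
      exact (hGd s hs).deriv
    · filter_upwards [hmem] with s hs
      have h1 := hfg s ⟨(hin s hs).1.1.le, (hin s hs).1.2.le⟩ (hin s hs).2
      have h2 := (hrad s hs).2
      have h3 := gJ_nonneg α h m ‖u s‖
      rw [Real.norm_eq_abs, abs_mul, abs_of_nonneg h3]
      change _ ≤ ‖deriv u s‖ ^ 2 + f s
      nlinarith [sq_nonneg (gJ α h m ‖u s‖ - ‖deriv u s‖), mul_le_mul_of_nonneg_left h2 h3,
        sq_nonneg (gJ α h m ‖u s‖ + ‖deriv u s‖)]
  set K := GJ α h m R with hK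
  have hPval : ∫ s in (0:ℝ)..τ, gJ α h m ‖u s‖ * r s = -K := by
    rw [integral_eq_sub_of_hasDerivAt_of_le hτ0.le hGc hGd hPint, hτz, hu0, hnq]
    simp [GJ, hK]
  set A := ∫ s in (0:ℝ)..1, N s with hA
  set B := ∫ s in (0:ℝ)..1, f s with hB
  have hMeq : Maupertuis α h U u = (1/2) * (A * B) := by
    rw [Maupertuis]; ring
  have hAs : A = (∫ s in (0:ℝ)..τ, N s) + ∫ s in τ..1, N s :=
    (integral_add_adjacent_intervals hN0 hN1).symm
  have hBs : B = (∫ s in (0:ℝ)..τ, f s) + ∫ s in τ..1, f s :=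
    (integral_add_adjacent_intervals hf00 hf01).symm
  have hNn : 0 ≤ ∫ s in τ..1, N s := integral_nonneg hτ1 (fun s _ => by positivity)
  have hfn : 0 ≤ ∫ s in τ..1, f s := by
    apply integral_nonneg_of_ae_restrict hτ1
    filter_upwards [ae_restrict_mem measurableSet_Icc, ae_restrict_of_ae hf0] with s hs h1
    exact h1 ⟨hτ0.le.trans hs.1, hs.2⟩
  have hAn : 0 ≤ A := integral_nonneg zero_le_one (fun s _ => by positivity)
  have hBn : 0 ≤ B := by
    apply integral_nonneg_of_ae_restrict zero_le_one
    filter_upwards [ae_restrict_mem measurableSet_Icc, ae_restrict_of_ae hf0] with s hs h1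
    exact h1 hs
  -- the calibrated defect
  set D : ℝ → ℝ → ℝ := fun μ s => μ ^ 2 * N s + f s + 2 * μ * (gJ α h m ‖u s‖ * r s) with hD
  have hDint : ∀ μ, IntervalIntegrable (D μ) volume 0 τ := fun μ =>
    ((hN0.const_mul _).add hf00).add (hPint.const_mul _)
  have hDval : ∀ μ, ∫ s in (0:ℝ)..τ, D μ s
      = μ ^ 2 * (∫ s in (0:ℝ)..τ, N s) + (∫ s in (0:ℝ)..τ, f s) - 2 * μ * K := by
    intro μ
    simp only [hD]
    rw [integral_add ((hN0.const_mul _).add hf00) (hPint.const_mul _),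
      integral_add (hN0.const_mul _) hf00, intervalIntegral.integral_const_mul,
      intervalIntegral.integral_const_mul, hPval]
    ring
  have hDn : ∀ μ, 0 ≤ μ → ∀ s ∈ Ioo 0 τ, 0 ≤ D μ s := fun μ hμ s hs =>
    D_nonneg hμ (norm_nonneg _) (gJ_nonneg _ _ _ _)
      (hfg s ⟨(hin s hs).1.1.le, (hin s hs).1.2.le⟩ (hin s hs).2) (hrad s hs).2
  have hDae : ∀ μ, 0 ≤ μ → 0 ≤ᵐ[volume.restrict (Ioc 0 τ)] D μ := by
    intro μ hμ
    rw [uIoc_of_le hτ0.le] at hmem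
    filter_upwards [hmem] with s hs
    exact hDn μ hμ s hs
  have hDI : ∀ μ, 0 ≤ μ → 0 ≤ ∫ s in (0:ℝ)..τ, D μ s := by
    intro μ hμ
    rw [integral_of_le hτ0.le]
    exact integral_nonneg_of_ae (hDae μ hμ)
  have hKpos : 0 < K := by
    have hp : ∀ x ∈ Ioo 0 R, 0 < gJ α h m x := fun x hx =>
      Real.sqrt_pos.2 (gpos_aux' hα0 hh hm hR hRle hx.1 hx.2)
    exact intervalIntegral_pos_of_pos_on (gJ_int hα0 hα hh hm R hR.le) hp hR
  have hquad : ∀ μ, 0 ≤ A * (μ * μ) + (-2 * K) * μ + B := by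
    intro μ
    rcases le_total 0 μ with hμ | hμ
    · have h1 := hDI μ hμ
      rw [hDval] at h1
      rw [hAs, hBs]
      nlinarith [mul_nonneg (sq_nonneg μ) hNn]
    · nlinarith [mul_nonneg hAn (mul_self_nonneg μ), mul_nonneg hKpos.le (neg_nonneg.2 hμ)]
  have hAB : K ^ 2 ≤ A * B := by
    have := discrim_le_zero hquad
    rw [discrim] at this
    nlinarith
  rw [hMeq]
  refine ⟨by linarith, fun hle => ?_⟩
  have hABe : A * B = K ^ 2 := by linarith
  have hApos : 0 < A := by
    refine lt_of_le_of_ne hAn fun h0 => ?_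
    rw [← h0] at hABe
    nlinarith [pow_pos hKpos 2]
  have hμ : 0 < K / A := div_pos hKpos hApos
  set μ := K / A with hμd
  have hzero : μ ^ 2 * A + B - 2 * μ * K = 0 := by
    rw [hμd]; field_simp; linarith
  have hDz : ∫ s in (0:ℝ)..τ, D μ s = 0 := by
    apply le_antisymm _ (hDI μ hμ.le)
    rw [hDval]
    rw [hAs, hBs] at hzero
    nlinarith [mul_nonneg (sq_nonneg μ) hNn]
  have hNz : ∫ s in τ..1, N s = 0 := by
    apply le_antisymm _ hNn
    have h1 := hDI μ hμ.le
    rw [hDval] at h1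
    rw [hAs, hBs] at hzero
    have h2 : 0 < μ ^ 2 := by positivity
    by_contra hcon
    nlinarith [mul_pos h2 (not_le.1 hcon)]
  have hrig : ∀ᵐ s ∂(volume.restrict (Ioc 0 τ)), r s = -‖deriv u s‖ := by
    have h1 := (integral_eq_zero_iff_of_le_of_nonneg_ae hτ0.le (hDae μ hμ.le) (hDint μ)).1 hDz
    rw [uIoc_of_le hτ0.le] at hmem
    filter_upwards [h1, hmem] with s hs hs1
    exact rigid_aux hμ (norm_nonneg _) (gJ_nonneg α h m ‖u s‖)
      (hfg s ⟨(hin s hs1).1.1.le, (hin s hs1).1.2.le⟩ (hin s hs1).2) (hrad s hs1).2 hs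
  -- integrability of the speed
  have hSint : IntervalIntegrable (deriv u) volume 0 1 := by
    refine (hI1.add (intervalIntegrable_const (c := (1:ℝ)))).mono_fun' (measurable_deriv u).aestronglyMeasurable ?_
    refine Filter.Eventually.of_forall fun s => ?_
    change _ ≤ ‖deriv u s‖ ^ 2 + 1
    nlinarith [sq_nonneg (‖deriv u s‖ - 1), norm_nonneg (deriv u s)]
  have hftc : ∀ s t, 0 ≤ s → s ≤ t → t ≤ 1 → ‖u t - u s‖ ≤ ∫ x in s..t, ‖deriv u x‖ := by
    intro s t hs hst ht
    have hsub : Icc s t ⊆ Icc (0:ℝ) 1 := Icc_subset_Icc hs ht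
    rw [← integral_eq_sub_of_hasDerivAt_of_le hst (hc.mono hsub)
      (fun x hx => (hd x ⟨hs.trans_lt hx.1, hx.2.trans_le ht⟩).hasDerivAt)
      (hSint.mono_set (by rw [uIcc_of_le hst, uIcc_of_le zero_le_one]; exact hsub))]
    exact norm_integral_le_integral_norm hst
  have hend : ∀ t, τ ≤ t → t ≤ 1 → u t = 0 := by
    intro t ht ht1
    have h1 : ∀ᵐ s ∂(volume.restrict (Ioc τ 1)), N s = 0 :=
      (integral_eq_zero_iff_of_le_of_nonneg_ae hτ1
        (Filter.Eventually.of_forall fun s => by positivity) hN1).1 hNz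
    have h2 : ∫ x in τ..t, ‖deriv u x‖ = 0 := by
      rw [integral_of_le ht]
      apply integral_eq_zero_of_ae
      filter_upwards [ae_restrict_of_ae_restrict_of_subset (Ioc_subset_Ioc le_rfl ht1) h1] with s hs
      simpa [hN] using hs
    have h3 := hftc τ t hτ0.le ht ht1
    rw [h2, hτz, sub_zero] at h3
    exact norm_le_zero_iff.1 h3
  intro s hs t ht hst
  rcases le_total τ t with htτ | htτ
  · rw [hend t htτ ht.2]; simp
  · have hri : IntervalIntegrable (fun x => -‖deriv u x‖) volume s t :=
      (hSint.mono_set (by rw [uIcc_of_le hst, uIcc_of_le zero_le_one]; exact Icc_subset_Icc hs.1 ht.2)).norm.neg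
    have hsubτ : Ioc s t ⊆ Ioc 0 τ := Ioc_subset_Ioc hs.1 htτ
    have hae2 : (fun x => -‖deriv u x‖) =ᵐ[volume.restrict (uIoc s t)] r := by
      rw [uIoc_of_le hst]
      filter_upwards [ae_restrict_of_ae_restrict_of_subset hsubτ hrig] with x hx
      exact hx.symm
    have h1 : ∫ x in s..t, r x = ‖u t‖ - ‖u s‖ :=
      integral_eq_sub_of_hasDerivAt_of_le hst (hnc.mono (Icc_subset_Icc hs.1 htτ))
        (fun x hx => (hrad x ⟨hs.1.trans_lt hx.1, hx.2.trans_le htτ⟩).1) (hri.congr_ae hae2)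
    have h2 := hftc s t hs.1 hst ht.2
    rw [← integral_congr_ae_restrict hae2, intervalIntegral.integral_neg] at h1
    rw [norm_sub_rev]
    linarith

/-- Uniqueness for homothetic initial data: for `q* = r* e^{iθ*}` with `θ*` a global
minimum of `U` on the circle and `0 < r* ≤ (−U(θ*)/h)^{1/α}`, the Maupertuis
functional has a (unique) minimizer in `H_coll^{q*}`, namely the monotone
`θ*`-homothetic collision arc: a minimizer of this form exists, and every
minimizer is of this form. -/
theorem homothetic_unique_minimizer
    (α h θstar rstar : ℝ) (hα : α ∈ Set.Ioo (0:ℝ) 2) (hh : h < 0)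
    (U : EuclideanSpace ℝ (Fin 2) → ℝ) (hUC2 : ContDiff ℝ 2 U)
    (hUpos : ∀ s : EuclideanSpace ℝ (Fin 2), ‖s‖ = 1 → 0 < U s)
    (hUglobalmin : ∀ s : EuclideanSpace ℝ (Fin 2), ‖s‖ = 1 →
      U (unitPt θstar) ≤ U s)
    (hr : 0 < rstar) (hrle : rstar ≤ (-(U (unitPt θstar)) / h) ^ (1/α)) :
    (∃ u, HcollQ α h U (rstar • unitPt θstar) u ∧
      IsMonotoneHomothetic θstar rstar u ∧
      (∀ v, HcollQ α h U (rstar • unitPt θstar) v →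
        Maupertuis α h U u ≤ Maupertuis α h U v)) ∧
    (∀ u, HcollQ α h U (rstar • unitPt θstar) u →
      (∀ v, HcollQ α h U (rstar • unitPt θstar) v →
        Maupertuis α h U u ≤ Maupertuis α h U v) →
      IsMonotoneHomothetic θstar rstar u) := by
  have hp : ‖unitPt θstar‖ = 1 := by
    rw [EuclideanSpace.norm_eq]
    simp [unitPt]
  have hm := hUpos _ hp
  obtain ⟨u₀, h1, h2, h3⟩ := candidate hα.1 hα.2 hh U θstar hp hm hr hrle
  have hlow := lower hα.1 hα.2 hh U _ hp hm hUglobalmin hr hrle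
  refine ⟨⟨u₀, h1, h2, fun v hv => h3.le.trans (hlow v hv).1⟩, fun u hu hmin => ?_⟩
  have hkey := (hlow u hu).2 ((hmin u₀ h1).trans h3.le)
  obtain ⟨-, -, hu0, hu1, -⟩ := hu
  have hnq : ‖rstar • unitPt θstar‖ = rstar := by
    rw [norm_smul, hp, mul_one, Real.norm_of_nonneg hr.le]
  refine ⟨fun s => ‖u s‖, fun s hs => ?_, by simp only [hu0, hnq], by simp [hu1],
    fun s _ => norm_nonneg _, fun s hs t ht hst => ?_⟩
  · have hk := hkey 0 (by simp) s hs hs.1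
    have hsr : SameRay ℝ (u s) (u 0 - u s) := by
      rw [sameRay_iff_norm_add]
      refine le_antisymm (norm_add_le _ _) ?_
      rw [add_sub_cancel]; linarith
    have hsr2 : SameRay ℝ (u s) (u 0) := by
      have := (SameRay.refl (u s)).add_right hsr
      rwa [add_sub_cancel] at this
    have := hsr2.norm_smul_eq
    rw [hu0, hnq, smul_smul, mul_comm, ← smul_smul] at this
    exact (smul_right_injective _ hr.ne' this.symm)
  · have := (norm_nonneg _).trans (hkey s hs t ht hst)
    simpa using this
end

section
/- Continuity of the minimal Maupertuis value: let h < 0, 0 < r* < r_LJ, θ* ∈ S¹, and ψ_h(q) = min_{H_coll^q} M_h. If h_k → h* ∈ (h,0), r_k → r* with 0 < r_k < r_LJ, and q_k = r_k e^{iθ_k} → q* = r* e^{iθ*}, then min_{H_coll^{q_k}} M_{h_k} ≤ min_{H_coll^{q*}} M_{h*} + O(|θ* − θ_k|) + O(|h* − h_k|) + O(|r* − r_k|) as k → ∞. -/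
open Set MeasureTheory intervalIntegral Filter

/-- The point `r e^{iθ}` of the plane. -/
noncomputable def circlePt (r θ : ℝ) : EuclideanSpace ℝ (Fin 2) :=
  r • (EuclideanSpace.equiv (Fin 2) ℝ).symm ![Real.cos θ, Real.sin θ]

abbrev E2 := EuclideanSpace ℝ (Fin 2)

/-- rotation by `t` -/
noncomputable def rotL (t : ℝ) : E2 →L[ℝ] E2 :=
  LinearMap.toContinuousLinearMap
    { toFun := fun x => !₂[Real.cos t * x 0 - Real.sin t * x 1, Real.sin t * x 0 + Real.cos t * x 1]
      map_add' := by
        intro x y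
        ext i
        fin_cases i <;> simp <;> ring
      map_smul' := by
        intro c x
        ext i
        fin_cases i <;> simp <;> ring }

lemma rotL_zero_apply (t : ℝ) (x : E2) : rotL t x 0 = Real.cos t * x 0 - Real.sin t * x 1 := by
  simp [rotL]

lemma rotL_one_apply (t : ℝ) (x : E2) : rotL t x 1 = Real.sin t * x 0 + Real.cos t * x 1 := by
  simp [rotL]

lemma normsq_E2 (x : E2) : ‖x‖ ^ 2 = x 0 ^ 2 + x 1 ^ 2 := by
  rw [EuclideanSpace.norm_sq_eq]; simp [Fin.sum_univ_two]

lemma norm_rotL (t : ℝ) (x : E2) : ‖rotL t x‖ = ‖x‖ := by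
  have h : ‖rotL t x‖ ^ 2 = ‖x‖ ^ 2 := by
    rw [normsq_E2, normsq_E2, rotL_zero_apply, rotL_one_apply]
    linear_combination (x 0 ^ 2 + x 1 ^ 2) * Real.sin_sq_add_cos_sq t
  exact (sq_eq_sq₀ (norm_nonneg _) (norm_nonneg _)).1 h

lemma norm_rotL_sub (t : ℝ) (x : E2) : ‖rotL t x - x‖ ≤ |t| * ‖x‖ := by
  apply abs_le_of_sq_le_sq' _ (by positivity) |>.2
  have h : ‖rotL t x - x‖ ^ 2 = (2 - 2 * Real.cos t) * ‖x‖ ^ 2 := by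
    rw [normsq_E2, normsq_E2, PiLp.sub_apply, PiLp.sub_apply, rotL_zero_apply, rotL_one_apply]
    linear_combination (x 0 ^ 2 + x 1 ^ 2) * Real.sin_sq_add_cos_sq t
  rw [h, mul_pow, sq_abs]
  have := Real.one_sub_sq_div_two_le_cos (x := t)
  gcongr
  linarith

lemma norm_circlePt (r θ : ℝ) (hr : 0 < r) : ‖circlePt r θ‖ = r := by
  have : ‖circlePt r θ‖ ^ 2 = r ^ 2 := by
    rw [normsq_E2]
    simp [circlePt]
    linear_combination (r ^ 2) * Real.sin_sq_add_cos_sq θ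
  exact (sq_eq_sq₀ (norm_nonneg _) hr.le).1 this

lemma circlePt_map (r1 θ1 r2 θ2 : ℝ) (hr : 0 < r1) :
    (r2 / r1) • rotL (θ2 - θ1) (circlePt r1 θ1) = circlePt r2 θ2 := by
  have e0 : Real.cos (θ2 - θ1) * Real.cos θ1 - Real.sin (θ2 - θ1) * Real.sin θ1 = Real.cos θ2 := by
    rw [← Real.cos_add]; simp
  have e1 : Real.sin (θ2 - θ1) * Real.cos θ1 + Real.cos (θ2 - θ1) * Real.sin θ1 = Real.sin θ2 := by
    rw [← Real.sin_add]; simp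
  have c0 : ∀ r θ, circlePt r θ 0 = r * Real.cos θ := by intro r θ; simp [circlePt]
  have c1 : ∀ r θ, circlePt r θ 1 = r * Real.sin θ := by intro r θ; simp [circlePt]
  ext i
  fin_cases i
  · change (r2 / r1) * rotL (θ2 - θ1) (circlePt r1 θ1) 0 = circlePt r2 θ2 0
    rw [rotL_zero_apply, c0, c1, c0, ← e0]; field_simp
  · change (r2 / r1) * rotL (θ2 - θ1) (circlePt r1 θ1) 1 = circlePt r2 θ2 1
    rw [rotL_one_apply, c0, c1, c1, ← e1]; field_simp

lemma Vpot_lower {α Umin : ℝ} {U : E2 → ℝ}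
    (hUmin : ∀ s : E2, ‖s‖ = 1 → Umin ≤ U s) {x : E2} (hx : x ≠ 0) :
    ‖x‖ ^ (-α) * Umin ≤ Vpot α U x := by
  unfold Vpot
  have := hUmin (‖x‖⁻¹ • x) (by rw [norm_smul, norm_inv, norm_norm]; field_simp [norm_ne_zero_iff.2 hx])
  gcongr

lemma Vpot_map {α Umin L lam t : ℝ} {U : E2 → ℝ}
    (hUmin : ∀ s : E2, ‖s‖ = 1 → Umin ≤ U s) (hpos : 0 < Umin) (hL : 0 ≤ L)
    (hU : ∀ x y : E2, ‖x‖ = 1 → ‖y‖ = 1 → U y ≤ U x + L * ‖y - x‖) (hlam : 0 < lam)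
    {x : E2} (hx : x ≠ 0) :
    Vpot α U (lam • rotL t x) ≤ lam ^ (-α) * (1 + L / Umin * |t|) * Vpot α U x := by
  unfold Vpot
  have hn : 0 < ‖x‖ := norm_pos_iff.2 hx
  have hy : ‖‖x‖⁻¹ • x‖ = 1 := by rw [norm_smul, norm_inv, norm_norm]; field_simp
  set y := ‖x‖⁻¹ • x with hyd
  have e1 : ‖lam • rotL t x‖ = lam * ‖x‖ := by
    rw [norm_smul, norm_rotL, Real.norm_of_nonneg hlam.le]
  have e2 : ‖lam • rotL t x‖⁻¹ • (lam • rotL t x) = rotL t y := by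
    rw [e1, hyd, map_smul, smul_smul]; congr 1; field_simp
  rw [e2, e1, Real.mul_rpow hlam.le hn.le]
  have h1 := hU y (rotL t y) hy (by rw [norm_rotL, hy])
  have h2 := norm_rotL_sub t y
  rw [hy, mul_one] at h2
  have h3 : L * ‖rotL t y - y‖ ≤ L * |t| := by gcongr
  have h4 : L * |t| ≤ L / Umin * |t| * U y := by
    have := hUmin y hy
    calc L * |t| = L / Umin * |t| * Umin := by field_simp
      _ ≤ _ := by gcongr
  have h5 : U (rotL t y) ≤ (1 + L / Umin * |t|) * U y := by linarith
  calc lam ^ (-α) * ‖x‖ ^ (-α) * U (rotL t y)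
      ≤ lam ^ (-α) * ‖x‖ ^ (-α) * ((1 + L / Umin * |t|) * U y) := by gcongr
    _ = _ := by ring

lemma measurable_Vpot {α : ℝ} {U : E2 → ℝ} (hU : Continuous U) : Measurable (Vpot α U) := by
  unfold Vpot
  have := hU.measurable
  fun_prop

lemma ae_Ioc {u : ℝ → E2} (h : ∀ᵐ s, s ∈ Icc (0:ℝ) 1 → u s ≠ 0) :
    ∀ᵐ s ∂(volume.restrict (Ioc (0:ℝ) 1)), u s ≠ 0 := by
  rw [ae_restrict_iff' measurableSet_Ioc]
  filter_upwards [h] with s hs hs' using hs (Ioc_subset_Icc_self hs')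

lemma Hcoll_Vint {α h : ℝ} {U : E2 → ℝ} {q : E2} {u : ℝ → E2} (hu : HcollQ α h U q u) :
    IntervalIntegrable (fun s => Vpot α U (u s)) volume 0 1 := by
  have := hu.2.2.2.2.2.2.2.sub (intervalIntegrable_const (c := h) (a := (0:ℝ)) (b := 1) (μ := volume))
  simpa using this

lemma deriv_map {lam t : ℝ} {u : ℝ → E2} {s : ℝ} (hu : DifferentiableAt ℝ u s) :
    deriv (fun s => lam • rotL t (u s)) s = lam • rotL t (deriv u s) :=
  (((rotL t).hasFDerivAt.comp_hasDerivAt s hu.hasDerivAt).const_smul lam).deriv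

lemma deriv_map_norm {lam t : ℝ} {u : ℝ → E2} 
    (hu : ∀ s ∈ Ioo (0:ℝ) 1, DifferentiableAt ℝ u s) :
    ∀ᵐ s, s ∈ Set.uIoc (0:ℝ) 1 → 
      ‖deriv (fun s => lam • rotL t (u s)) s‖ ^ 2 = lam ^ 2 * ‖deriv u s‖ ^ 2 := by
  have : ∀ᵐ s : ℝ, s ≠ 1 := by simp [ae_iff]
  filter_upwards [this] with s hs1 hs
  rw [uIoc_of_le zero_le_one] at hs
  rw [deriv_map (hu s ⟨hs.1, lt_of_le_of_ne hs.2 hs1⟩), norm_smul, norm_rotL, mul_pow,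
    Real.norm_eq_abs, sq_abs]

lemma Hcoll_map {α h h' Umin L lam t : ℝ} {U : E2 → ℝ} (hUc : Continuous U)
    (hUmin : ∀ s : E2, ‖s‖ = 1 → Umin ≤ U s) (hpos : 0 < Umin) (hL : 0 ≤ L)
    (hU : ∀ x y : E2, ‖x‖ = 1 → ‖y‖ = 1 → U y ≤ U x + L * ‖y - x‖) (hlam : 0 < lam)
    {q : E2} {u : ℝ → E2} (hu : HcollQ α h U q u) :
    HcollQ α h' U (lam • rotL t q) (fun s => lam • rotL t (u s)) := by
  have hV := Hcoll_Vint hu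
  obtain ⟨hc, hd, h0, h1, hb, hne, hK, -⟩ := hu
  have hc' : ContinuousOn (fun s => lam • rotL t (u s)) (Icc 0 1) :=
    ((rotL t).continuous.comp_continuousOn hc).const_smul lam
  have hinj : ∀ x : E2, x ≠ 0 → lam • rotL t x ≠ 0 := by
    intro x hx
    rw [← norm_ne_zero_iff, norm_smul, norm_rotL]
    simp [hlam.ne', hx]
  refine ⟨hc', ?_, ?_, ?_, ?_, ?_, ?_, ?_⟩
  · intro s hs
    exact ((rotL t).differentiableAt.comp s (hd s hs)).const_smul lam
  · simp [h0]
  · simp [h1]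
  · intro s hs
    rw [norm_smul, norm_smul, norm_rotL, norm_rotL]
    have := hb s hs
    gcongr
  · filter_upwards [hne] with s hs hs' using hinj _ (hs hs')
  · refine (hK.const_mul (lam ^ 2)).congr_ae ?_
    rw [EventuallyEq, ae_restrict_iff' measurableSet_uIoc]
    filter_upwards [deriv_map_norm (lam := lam) (t := t) hd] with s hs hs' using (hs hs').symm
  · refine (intervalIntegrable_const).add ?_
    refine (hV.const_mul (lam ^ (-α) * (1 + L / Umin * |t|))).mono_fun ?_ ?_
    · rw [uIoc_of_le zero_le_one]
      exact ((measurable_Vpot hUc).comp_aemeasurable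
        ((hc'.mono Ioc_subset_Icc_self).aemeasurable measurableSet_Ioc)).aestronglyMeasurable
    · rw [uIoc_of_le zero_le_one]
      filter_upwards [ae_Ioc hne] with s hs
      have h1 := Vpot_map (α := α) (t := t) hUmin hpos hL hU hlam hs
      have h2 := Vpot_lower (α := α) hUmin (hinj _ hs)
      have h3 : 0 ≤ Vpot α U (lam • rotL t (u s)) := le_trans (by positivity) h2
      rw [Real.norm_of_nonneg h3]
      exact h1.trans (le_abs_self _)

lemma Mau_map {α h h' Umin L lam t : ℝ} {U : E2 → ℝ} (hUc : Continuous U)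
    (hUmin : ∀ s : E2, ‖s‖ = 1 → Umin ≤ U s) (hpos : 0 < Umin) (hL : 0 ≤ L)
    (hU : ∀ x y : E2, ‖x‖ = 1 → ‖y‖ = 1 → U y ≤ U x + L * ‖y - x‖) (hlam : 0 < lam)
    {q : E2} {u : ℝ → E2} (hu : HcollQ α h U q u) :
    Maupertuis α h' U (fun s => lam • rotL t (u s)) ≤
      lam ^ 2 * ((1/2) * ∫ s in (0:ℝ)..1, ‖deriv u s‖ ^ 2) *
       (h' + lam ^ (-α) * (1 + L / Umin * |t|) * ∫ s in (0:ℝ)..1, Vpot α U (u s)) := by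
  have hv := Hcoll_map (h' := h') (t := t) hUc hUmin hpos hL hU hlam hu
  have hV := Hcoll_Vint hu
  have hV' := Hcoll_Vint hv
  unfold Maupertuis
  rw [intervalIntegral.integral_congr_ae (deriv_map_norm hu.2.1),
    intervalIntegral.integral_const_mul,
    intervalIntegral.integral_add intervalIntegrable_const hV', ← intervalIntegral.integral_const_mul,
    ← intervalIntegral.integral_const_mul (lam ^ (-α) * (1 + L / Umin * |t|))]
  have hle : ∫ s in (0:ℝ)..1, Vpot α U (lam • rotL t (u s)) ≤
      ∫ s in (0:ℝ)..1, lam ^ (-α) * (1 + L / Umin * |t|) * Vpot α U (u s) := by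
    apply intervalIntegral.integral_mono_ae_restrict zero_le_one hV' (hV.const_mul _)
    rw [restrict_Ioc_eq_restrict_Icc.symm]
    filter_upwards [ae_Ioc hu.2.2.2.2.2.1] with s hs
    exact Vpot_map (α := α) (t := t) hUmin hpos hL hU hlam hs
  have hK : 0 ≤ ∫ s in (0:ℝ)..1, ‖deriv u s‖ ^ 2 :=
    intervalIntegral.integral_nonneg zero_le_one (fun _ _ => by positivity)
  rw [intervalIntegral.integral_const_mul]
  simp only [intervalIntegral.integral_const, sub_zero, one_smul]
  calc _ = lam ^ 2 * ((1/2) * ∫ s in (0:ℝ)..1, ‖deriv u s‖ ^ 2) * 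
        (h' + ∫ s in (0:ℝ)..1, Vpot α U (lam • rotL t (u s))) := by ring
    _ ≤ _ := by gcongr

/-- lower bound of the potential integral inside the Lagrange-Jacobi radius -/
lemma V_int_lower {α h h' Umin r : ℝ} (hα : α ∈ Set.Ioo (0:ℝ) 2) (hh : h < 0)
    {U : E2 → ℝ} (hUmin : ∀ s : E2, ‖s‖ = 1 → Umin ≤ U s) (hpos : 0 < Umin)
    (hr0 : 0 < r) (hr : r < ((2 - α) * Umin / (-2 * h)) ^ (1/α))
    {q : E2} {u : ℝ → E2} (hq : ‖q‖ = r) (hu : HcollQ α h' U q u) :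
    -h ≤ ∫ s in (0:ℝ)..1, Vpot α U (u s) := by
  obtain ⟨hα0, hα2⟩ := hα
  have hB : 0 < (2 - α) * Umin / (-2 * h) := by
    apply div_pos <;> nlinarith
  have h1 : r ^ α < (2 - α) * Umin / (-2 * h) := by
    have := Real.rpow_lt_rpow hr0.le hr hα0
    rwa [← Real.rpow_mul hB.le, one_div, inv_mul_cancel₀ hα0.ne', Real.rpow_one] at this
  have h2 : -h ≤ r ^ (-α) * Umin := by
    rw [Real.rpow_neg hr0.le, inv_mul_eq_div, le_div_iff₀ (by positivity)]
    rw [lt_div_iff₀ (by linarith)] at h1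
    nlinarith
  have hV := Hcoll_Vint hu
  have : ∫ s in (0:ℝ)..1, (-h) ≤ ∫ s in (0:ℝ)..1, Vpot α U (u s) := by
    apply intervalIntegral.integral_mono_ae_restrict zero_le_one intervalIntegrable_const hV
    rw [restrict_Ioc_eq_restrict_Icc.symm]
    filter_upwards [ae_Ioc hu.2.2.2.2.2.1, ae_restrict_mem measurableSet_Ioc] with s hs hs'
    refine h2.trans (le_trans ?_ (Vpot_lower hUmin hs))
    have hb := hu.2.2.2.2.1 s (Ioc_subset_Icc_self hs')
    rw [hq] at hb
    have := Real.rpow_le_rpow_of_nonpos (norm_pos_iff.2 hs) hb (by linarith : -α ≤ 0)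
    gcongr
  simpa using this

lemma Mau_eq {α h : ℝ} {U : E2 → ℝ} {q : E2} {u : ℝ → E2} (hu : HcollQ α h U q u) :
    Maupertuis α h U u = ((1/2) * ∫ s in (0:ℝ)..1, ‖deriv u s‖ ^ 2) *
      (h + ∫ s in (0:ℝ)..1, Vpot α U (u s)) := by
  unfold Maupertuis
  rw [intervalIntegral.integral_add intervalIntegrable_const (Hcoll_Vint hu)]
  simp

lemma half_K_nonneg (u : ℝ → E2) : 0 ≤ (1/2) * ∫ s in (0:ℝ)..1, ‖deriv u s‖ ^ 2 := by
  have : 0 ≤ ∫ s in (0:ℝ)..1, ‖deriv u s‖ ^ 2 :=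
    intervalIntegral.integral_nonneg zero_le_one (fun _ _ => by positivity)
  positivity

lemma U_lip {U : E2 → ℝ} (hUC2 : ContDiff ℝ 2 U) :
    ∃ L, 0 ≤ L ∧ ∀ x y : E2, ‖x‖ = 1 → ‖y‖ = 1 → U y ≤ U x + L * ‖y - x‖ := by
  obtain ⟨K, hK⟩ := (hUC2.of_le (by norm_num : (1 : WithTop ℕ∞) ≤ 2)).contDiffOn.exists_lipschitzOnWith
    one_ne_zero (convex_closedBall (0 : E2) 1) (isCompact_closedBall _ _)
  refine ⟨K, K.2, fun x y hx hy => ?_⟩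
  have := hK.dist_le_mul y (by simp [hy]) x (by simp [hx])
  rw [Real.dist_eq, dist_eq_norm] at this
  linarith [le_abs_self (U y - U x)]

/-- the arithmetic at the heart of the estimate -/
lemma arith_bound {α A P hs hk lam a d B D : ℝ} (hα : α ∈ Set.Ioo (0:ℝ) 2) (hA : 0 ≤ A)
    (hP : 0 ≤ P) (hlam : 0 < lam) (hlam2 : lam ≤ 2) (ha : 0 ≤ a) (hd : 0 ≤ d)
    (hB : A ≤ B) (hD : A * P ≤ D) :
    lam ^ 2 * A * (hk + lam ^ (-α) * (1 + a * d) * P) ≤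
      A * (hs + P) + (B * (4 * |hs - hk| + 3 * |hs| * |lam - 1|) 
        + D * (3 * |lam - 1| + 4 * a * d)) := by
  obtain ⟨hα0, hα2⟩ := hα
  set δ := |lam - 1| with hδ
  have hδ1 : δ ≤ 1 := by rw [hδ, abs_le]; constructor <;> linarith
  have hδ0 : 0 ≤ δ := abs_nonneg _
  have hsq : |lam ^ 2 - 1| ≤ 3 * δ := by
    have : lam ^ 2 - 1 = (lam + 1) * (lam - 1) := by ring
    rw [this, abs_mul, abs_of_pos (by linarith : 0 < lam + 1)]
    gcongr
    linarith
  have hpw : lam ^ 2 * lam ^ (-α) ≤ 1 + 3 * δ := by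
    rw [← Real.rpow_natCast, ← Real.rpow_add hlam]
    rcases le_total lam 1 with h | h
    · have := Real.rpow_le_one hlam.le h (z := ((2:ℕ):ℝ) + -α) (by push_cast; linarith)
      linarith
    · have := Real.rpow_le_rpow_of_exponent_le h (y := ((2:ℕ):ℝ) + -α) (z := ((2:ℕ):ℝ)) (by linarith)
      rw [Real.rpow_natCast] at this
      linarith [le_abs_self (lam ^ 2 - 1)]
  have t1 : lam ^ 2 * hk ≤ hs + (4 * |hs - hk| + 3 * |hs| * δ) := by
    have e : lam ^ 2 * hk = hs + (lam ^ 2 * (hk - hs) + hs * (lam ^ 2 - 1)) := by ring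
    have i1 : lam ^ 2 * (hk - hs) ≤ 4 * |hs - hk| := by
      calc lam ^ 2 * (hk - hs) ≤ lam ^ 2 * |hs - hk| := by
            rw [abs_sub_comm]; gcongr; exact le_abs_self _
        _ ≤ _ := by gcongr; nlinarith
    have i2 : hs * (lam ^ 2 - 1) ≤ |hs| * (3 * δ) := by
      refine (le_abs_self _).trans ?_
      rw [abs_mul]; gcongr
    linarith
  have t2 : lam ^ 2 * lam ^ (-α) * (1 + a * d) ≤ 1 + (3 * δ + 4 * a * d) := by
    have had : 0 ≤ a * d := by positivity
    calc _ ≤ (1 + 3 * δ) * (1 + a * d) := by gcongr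
      _ ≤ _ := by nlinarith
  calc _ = A * (lam ^ 2 * hk) + A * P * (lam ^ 2 * lam ^ (-α) * (1 + a * d)) := by ring
    _ ≤ A * (hs + (4 * |hs - hk| + 3 * |hs| * δ)) + A * P * (1 + (3 * δ + 4 * a * d)) := by gcongr
    _ = A * (hs + P) + (A * (4 * |hs - hk| + 3 * |hs| * δ) + A * P * (3 * δ + 4 * a * d)) := by ring
    _ ≤ _ := by gcongr

/-- Continuity of the minimal Maupertuis value under perturbations of the
energy, the radius and the angle of the starting point:
`min_{H_coll^{q_k}} M_{h_k} ≤ min_{H_coll^{q*}} M_{h*} + O(|θ*−θ_k|) + O(|h*−h_k|) + O(|r*−r_k|)`. -/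
theorem minimal_value_continuity
    (α h hstar Umin rstar θstar : ℝ) (hα : α ∈ Set.Ioo (0:ℝ) 2) (hh : h < 0)
    (U : EuclideanSpace ℝ (Fin 2) → ℝ) (hUC2 : ContDiff ℝ 2 U)
    (hUmin : ∀ s : EuclideanSpace ℝ (Fin 2), ‖s‖ = 1 → Umin ≤ U s)
    (hUminpos : 0 < Umin)
    (hrstar : 0 < rstar) (hrstarLJ : rstar < ((2 - α) * Umin / (-2 * h)) ^ (1/α))
    (hhstar : hstar ∈ Set.Ioo h 0)
    (hk : ℕ → ℝ) (rk : ℕ → ℝ) (θk : ℕ → ℝ)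
    (hhk : ∀ k, hk k ∈ Set.Ioo h 0) (hhklim : Tendsto hk atTop (nhds hstar))
    (hrk : ∀ k, 0 < rk k ∧ rk k < ((2 - α) * Umin / (-2 * h)) ^ (1/α))
    (hrklim : Tendsto rk atTop (nhds rstar))
    (hqklim : Tendsto (fun k => circlePt (rk k) (θk k)) atTop
      (nhds (circlePt rstar θstar))) :
    ∃ C > (0:ℝ), ∀ᶠ k in atTop,
      sInf (Maupertuis α (hk k) U '' {u | HcollQ α (hk k) U (circlePt (rk k) (θk k)) u}) ≤
        sInf (Maupertuis α hstar U '' {u | HcollQ α hstar U (circlePt rstar θstar) u}) +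
        C * (|θstar - θk k| + |hstar - hk k| + |rstar - rk k|) := by
  obtain ⟨L, hL, hU⟩ := U_lip hUC2
  have hUc : Continuous U := hUC2.continuous
  have nonneg : ∀ k, ∀ M ∈ Maupertuis α (hk k) U ''
      {u | HcollQ α (hk k) U (circlePt (rk k) (θk k)) u}, 0 ≤ M := by
    rintro k _ ⟨u, hu, rfl⟩
    have := V_int_lower hα hh hUmin hUminpos (hrk k).1 (hrk k).2
      (norm_circlePt _ (θk k) (hrk k).1) hu
    rw [Mau_eq hu]
    have h2 := (hhk k).1
    exact mul_nonneg (half_K_nonneg u) (by linarith)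
  set S := Maupertuis α hstar U '' {u | HcollQ α hstar U (circlePt rstar θstar) u} with hS
  by_cases hne : S.Nonempty
  swap
  · refine ⟨1, one_pos, Eventually.of_forall fun k => ?_⟩
    have hSe : S = ∅ := Set.not_nonempty_iff_eq_empty.1 hne
    have hke : Maupertuis α (hk k) U ''
        {u | HcollQ α (hk k) U (circlePt (rk k) (θk k)) u} = ∅ := by
      rw [← Set.not_nonempty_iff_eq_empty]
      rintro ⟨_, u, hu, rfl⟩
      apply hne
      have := Hcoll_map (h' := hstar) (lam := rstar / rk k) (t := θstar - θk k) hUc hUmin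
        hUminpos hL hU (div_pos hrstar (hrk k).1) hu
      rw [circlePt_map _ _ _ _ (hrk k).1] at this
      exact ⟨_, _, this, rfl⟩
    rw [hSe, hke, Real.sInf_empty]
    positivity
  set m := sInf S with hm
  have hc : 0 < hstar - h := sub_pos.2 hhstar.1
  have Snn : ∀ M ∈ S, 0 ≤ M := by
    rintro _ ⟨u, hu, rfl⟩
    have := V_int_lower hα hh hUmin hUminpos hrstar hrstarLJ
      (norm_circlePt _ θstar hrstar) hu
    rw [Mau_eq hu]
    exact mul_nonneg (half_K_nonneg u) (by linarith)
  have hm0 : 0 ≤ m := Real.sInf_nonneg Snn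
  set B := (m + 1) / (hstar - h) with hB
  have hB0 : 0 ≤ B := by positivity
  set D := m + 1 + |hstar| * B with hD
  have hD0 : 0 ≤ D := by positivity
  set a := L / Umin with hadef
  have ha : 0 ≤ a := by positivity
  set C := B * 4 + (B * (3 * |hstar|) + D * 3) / rstar + D * (4 * a) + 1 with hC
  refine ⟨C, by positivity, ?_⟩
  have hev : ∀ᶠ k in atTop, rk k < 2 * rstar :=
    hrklim.eventually (gt_mem_nhds (by linarith))
  filter_upwards [hev] with k hk2
  set lam := rk k / rstar with hlamdef
  have hlam : 0 < lam := div_pos (hrk k).1 hrstar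
  have hlam2 : lam ≤ 2 := by rw [hlamdef, div_le_iff₀ hrstar]; exact hk2.le
  have hdel : |lam - 1| = |rstar - rk k| / rstar := by
    have : lam - 1 = (rk k - rstar) / rstar := by rw [hlamdef]; field_simp
    rw [this, abs_div, abs_of_pos hrstar, abs_sub_comm]
  have key : ∀ ε, 0 < ε → ε ≤ 1 → sInf (Maupertuis α (hk k) U ''
      {u | HcollQ α (hk k) U (circlePt (rk k) (θk k)) u}) ≤
      m + C * (|θstar - θk k| + |hstar - hk k| + |rstar - rk k|) + ε := by
    intro ε hε hε1
    obtain ⟨_, ⟨u, hu, rfl⟩, hlt⟩ := exists_lt_of_csInf_lt hne (by linarith : sInf S < m + ε)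
    have hv := Hcoll_map (h' := hk k) (lam := lam) (t := θk k - θstar) hUc hUmin
        hUminpos hL hU hlam hu
    rw [circlePt_map _ _ _ _ hrstar] at hv
    refine (csInf_le ⟨0, nonneg k⟩ ⟨_, hv, rfl⟩).trans ?_
    refine (Mau_map (h' := hk k) (t := θk k - θstar) hUc hUmin hUminpos hL hU hlam hu).trans ?_
    have hP := V_int_lower hα hh hUmin hUminpos hrstar hrstarLJ
      (norm_circlePt _ θstar hrstar) hu
    have hA := half_K_nonneg u
    rw [Mau_eq hu] at hlt
    set A := (1/2) * ∫ s in (0:ℝ)..1, ‖deriv u s‖ ^ 2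
    set P := ∫ s in (0:ℝ)..1, Vpot α U (u s)
    have hAB : A ≤ B := by
      rw [hB, le_div_iff₀ hc]
      have : A * (hstar - h) ≤ A * (hstar + P) := by gcongr; linarith
      linarith
    have hAP : A * P ≤ D := by
      have h1 : -hstar * A ≤ |hstar| * B :=
        mul_le_mul (neg_le_abs _) hAB hA (abs_nonneg _)
      rw [hD]; linarith
    refine (arith_bound (hs := hstar) hα hA (by linarith) hlam hlam2 ha
      (abs_nonneg (θk k - θstar)) hAB hAP).trans ?_
    rw [hdel, abs_sub_comm (θk k)]
    set x := |θstar - θk k|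
    set y := |hstar - hk k|
    set z := |rstar - rk k|
    have hx : 0 ≤ x := abs_nonneg _
    have hy : 0 ≤ y := abs_nonneg _
    have hz : 0 ≤ z := abs_nonneg _
    have e : B * (4 * y + 3 * |hstar| * (z / rstar)) + D * (3 * (z / rstar) + 4 * a * x)
      = (B * 4) * y + ((B * (3 * |hstar|) + D * 3) / rstar) * z + (D * (4 * a)) * x := by
      field_simp
      ring
    rw [e]
    have p1 : 0 ≤ B * 4 := by positivity
    have p2 : 0 ≤ (B * (3 * |hstar|) + D * 3) / rstar := by positivity
    have p3 : 0 ≤ D * (4 * a) := by positivity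
    have q1 : (B * 4) * y ≤ C * y := by gcongr; linarith
    have q2 : ((B * (3 * |hstar|) + D * 3) / rstar) * z ≤ C * z := by gcongr; linarith
    have q3 : (D * (4 * a)) * x ≤ C * x := by gcongr; linarith
    linarith
  refine le_of_forall_pos_le_add fun ε hε => ?_
  have := key (min ε 1) (lt_min hε one_pos) (min_le_right _ _)
  linarith [min_le_left ε 1]
end
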